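/- The set of decomposable permutations in S_n is downward closed in the Bruhat order: if w ∈ S_n is decomposable and v ≤ w in the Bruhat order, then v is decomposable. -/

import Mathlib

namespace Paper

/-! ### Type A: the symmetric group `S_n` as `Equiv.Perm (Fin n)` -/

/-- The simple transposition `s_i ∈ S_n` (1-indexed letter `i`, meaningful for
`1 ≤ i ≤ n-1`): it interchanges the entries in (1-indexed) positions `i` and `i+1`,
i.e. (0-indexed) positions `i-1` and `i` of `Fin n`. Out-of-range letters give `1`. -/
def sA (n : ℕ) (i : ℕ) : Equiv.Perm (Fin n) :=
  if h : 1 ≤ i ∧ i < n then Equiv.swap ⟨i - 1, by omega⟩ ⟨i, h.2⟩ else 1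

/-- The product `s_{i_1} ⋯ s_{i_ℓ}` of a word `i_1 ⋯ i_ℓ`. -/
def prodA (n : ℕ) (w : List ℕ) : Equiv.Perm (Fin n) := (w.map (sA n)).prod

/-- A word in the letters `{1, …, n-1}`. -/
def IsWordA (n : ℕ) (w : List ℕ) : Prop := ∀ i ∈ w, 1 ≤ i ∧ i ≤ n - 1

/-- `w` is a reduced decomposition of `x ∈ S_n`. -/
def ReducedA (n : ℕ) (w : List ℕ) (x : Equiv.Perm (Fin n)) : Prop :=
  IsWordA n w ∧ prodA n w = x ∧
    ∀ w' : List ℕ, IsWordA n w' → prodA n w' = x → w.length ≤ w'.length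

/-- The Coxeter length `ℓ(x)`: minimal length of a word for `x`. -/
noncomputable def lenA (n : ℕ) (x : Equiv.Perm (Fin n)) : ℕ :=
  sInf {l | ∃ w : List ℕ, IsWordA n w ∧ prodA n w = x ∧ w.length = l}

/-- Bruhat order on `S_n`: `v ≤ w` iff some reduced decomposition of `v` is a
(not necessarily consecutive) subword of some reduced decomposition of `w`. -/
def bruhatA (n : ℕ) (v w : Equiv.Perm (Fin n)) : Prop :=
  ∃ a b : List ℕ, ReducedA n a v ∧ ReducedA n b w ∧ a.Sublist b

/-- `w ∈ S_n` is boolean: the principal order ideal `B(w)`, ordered by the Bruhat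
order, is order-isomorphic to the lattice of all subsets of `{1,…,r}` for some `r`. -/
def BooleanA (n : ℕ) (w : Equiv.Perm (Fin n)) : Prop :=
  ∃ (r : ℕ) (e : {v : Equiv.Perm (Fin n) // bruhatA n v w} ≃ Finset (Fin r)),
    ∀ a b : {v : Equiv.Perm (Fin n) // bruhatA n v w}, bruhatA n a.1 b.1 ↔ e a ⊆ e b

/-- Pattern containment: `w ∈ S_n` contains `p ∈ S_k`. -/
def ContainsA {n k : ℕ} (w : Equiv.Perm (Fin n)) (p : Equiv.Perm (Fin k)) : Prop :=
  ∃ f : Fin k → Fin n, StrictMono f ∧ ∀ a b : Fin k, w (f a) < w (f b) ↔ p a < p b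

/-- Pattern avoidance. -/
def AvoidsA {n k : ℕ} (w : Equiv.Perm (Fin n)) (p : Equiv.Perm (Fin k)) : Prop :=
  ¬ ContainsA w p

/-- The pattern `321` (one-line notation). -/
def p321 : Equiv.Perm (Fin 3) := ⟨![2,1,0], ![2,1,0], by decide, by decide⟩
/-- The pattern `231` (one-line notation). -/
def p231 : Equiv.Perm (Fin 3) := ⟨![1,2,0], ![2,0,1], by decide, by decide⟩
/-- The pattern `312` (one-line notation). -/
def p312 : Equiv.Perm (Fin 3) := ⟨![2,0,1], ![1,2,0], by decide, by decide⟩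
/-- The pattern `3412` (one-line notation). -/
def p3412 : Equiv.Perm (Fin 4) := ⟨![2,3,0,1], ![2,3,0,1], by decide, by decide⟩

/-- The longest (decreasing) permutation `w_0^{(k)} = k (k-1) ⋯ 2 1 ∈ S_k`. -/
def w0 (k : ℕ) : Equiv.Perm (Fin k) := Fin.revPerm

/-- The shift of a word by `M`: each letter `i` becomes `i + M`. -/
def shift (M : ℕ) (w : List ℕ) : List ℕ := w.map (· + M)




/-! ### Types B and D: signed permutations, modelled as permutations `w` of `ℤ`
with `w(-x) = -w(x)` that fix all integers of absolute value `> n`. -/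

/-- The simple generators of `S_n^B`, as permutations of `ℤ`:
`sB 0` negates the value `1`; for `i ≥ 1`, `sB i` interchanges the values
`i` and `i+1` (and `-i` and `-(i+1)`). -/
def sB : ℕ → Equiv.Perm ℤ
  | 0 => Equiv.swap 1 (-1)
  | (i+1) => Equiv.swap ((i : ℤ) + 1) ((i : ℤ) + 2) * Equiv.swap (-((i : ℤ) + 1)) (-((i : ℤ) + 2))

/-- The simple generators of `S_n^D`: letter `0` encodes `s_{1'} = s_0 s_1 s_0`
(mapping `1 ↦ -2` and `2 ↦ -1`), and letters `i ≥ 1` are as in type `B`. -/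
def sD : ℕ → Equiv.Perm ℤ
  | 0 => sB 0 * sB 1 * sB 0
  | (i+1) => sB (i+1)

def prodB (w : List ℕ) : Equiv.Perm ℤ := (w.map sB).prod
def prodD (w : List ℕ) : Equiv.Perm ℤ := (w.map sD).prod

/-- A word in the type `B`/`D` letters `{0, 1, …, n-1}`. -/
def IsWordBD (n : ℕ) (w : List ℕ) : Prop := ∀ i ∈ w, i ≤ n - 1

/-- `w` is a reduced decomposition of `x ∈ S_n^B`. -/
def ReducedB (n : ℕ) (w : List ℕ) (x : Equiv.Perm ℤ) : Prop :=
  IsWordBD n w ∧ prodB w = x ∧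
    ∀ w' : List ℕ, IsWordBD n w' → prodB w' = x → w.length ≤ w'.length

/-- `w` is a reduced decomposition of `x ∈ S_n^D`. -/
def ReducedD (n : ℕ) (w : List ℕ) (x : Equiv.Perm ℤ) : Prop :=
  IsWordBD n w ∧ prodD w = x ∧
    ∀ w' : List ℕ, IsWordBD n w' → prodD w' = x → w.length ≤ w'.length

/-- Length in `S_n^B`. -/
noncomputable def lenB (n : ℕ) (x : Equiv.Perm ℤ) : ℕ :=
  sInf {l | ∃ w : List ℕ, IsWordBD n w ∧ prodB w = x ∧ w.length = l}

/-- Length in `S_n^D`. -/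
noncomputable def lenD (n : ℕ) (x : Equiv.Perm ℤ) : ℕ :=
  sInf {l | ∃ w : List ℕ, IsWordBD n w ∧ prodD w = x ∧ w.length = l}

/-- Bruhat order on `S_n^B`. -/
def bruhatB (n : ℕ) (v w : Equiv.Perm ℤ) : Prop :=
  ∃ a b : List ℕ, ReducedB n a v ∧ ReducedB n b w ∧ a.Sublist b

/-- Bruhat order on `S_n^D`. -/
def bruhatD (n : ℕ) (v w : Equiv.Perm ℤ) : Prop :=
  ∃ a b : List ℕ, ReducedD n a v ∧ ReducedD n b w ∧ a.Sublist b

/-- `w` is an element of `S_n^B`: an "odd" permutation of `{±1, …, ±n}`. -/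
def IsSignedPerm (n : ℕ) (w : Equiv.Perm ℤ) : Prop :=
  (∀ x : ℤ, w (-x) = - w x) ∧ ∀ x : ℤ, (n : ℤ) < |x| → w x = x

/-- `w` is an element of `S_n^D`: a signed permutation with an even number of
negative values in its one-line notation. -/
def IsTypeD (n : ℕ) (w : Equiv.Perm ℤ) : Prop :=
  IsSignedPerm n w ∧ Even (((Finset.Icc (1 : ℤ) n).filter (fun x => w x < 0)).card)

/-- `w ∈ S_n^B` is boolean (for the type `B` Bruhat order). -/
def BooleanB (n : ℕ) (w : Equiv.Perm ℤ) : Prop :=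
  ∃ (r : ℕ) (e : {v : Equiv.Perm ℤ // bruhatB n v w} ≃ Finset (Fin r)),
    ∀ a b : {v : Equiv.Perm ℤ // bruhatB n v w}, bruhatB n a.1 b.1 ↔ e a ⊆ e b

/-- `w ∈ S_n^D` is boolean (for the type `D` Bruhat order). -/
def BooleanD (n : ℕ) (w : Equiv.Perm ℤ) : Prop :=
  ∃ (r : ℕ) (e : {v : Equiv.Perm ℤ // bruhatD n v w} ≃ Finset (Fin r)),
    ∀ a b : {v : Equiv.Perm ℤ // bruhatD n v w}, bruhatD n a.1 b.1 ↔ e a ⊆ e b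

/-- Signed pattern containment, where the pattern is given by its one-line
notation `p` (a list of nonzero integers): there are positions
`1 ≤ f 0 < ⋯ < f (k-1) ≤ n` such that each `w (f j)` has the same sign as the
`j`-th entry of `p`, and the absolute values appear in the same relative order. -/
def containsPat (n : ℕ) (w : Equiv.Perm ℤ) (p : List ℤ) : Prop :=
  ∃ f : Fin p.length → ℤ, StrictMono f ∧ (∀ j, 1 ≤ f j ∧ f j ≤ (n : ℤ)) ∧
    (∀ j, 0 < w (f j) ↔ 0 < p.get j) ∧
    (∀ j j', |w (f j)| < |w (f j')| ↔ |p.get j| < |p.get j'|)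

/-- Signed pattern avoidance. -/
def avoidsPat (n : ℕ) (w : Equiv.Perm ℤ) (p : List ℤ) : Prop := ¬ containsPat n w p


/-! ### Extra definitions used in some statements -/

/-- `w ∈ S_n` is decomposable: `B(w) ≅ B(u) × B(v)` (as posets under Bruhat order)
for some `u ∈ S_m`, `v ∈ S_{m'}` with `m, m' < n`. -/
def Decomposable (n : ℕ) (w : Equiv.Perm (Fin n)) : Prop :=
  ∃ (m m' : ℕ), m < n ∧ m' < n ∧
    ∃ (u : Equiv.Perm (Fin m)) (v : Equiv.Perm (Fin m'))
      (e : {x : Equiv.Perm (Fin n) // bruhatA n x w} ≃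
        {y : Equiv.Perm (Fin m) // bruhatA m y u} × {z : Equiv.Perm (Fin m') // bruhatA m' z v}),
      ∀ a b : {x : Equiv.Perm (Fin n) // bruhatA n x w},
        bruhatA n a.1 b.1 ↔
          (bruhatA m ((e a).1).1 ((e b).1).1 ∧ bruhatA m' ((e a).2).1 ((e b).2).1)

/-- `w` is decreasing on the set of positions `T`. -/
def DecrOn (n : ℕ) (w : Equiv.Perm (Fin n)) (T : Finset (Fin n)) : Prop :=
  ∀ a ∈ T, ∀ b ∈ T, a < b → w b < w a

/-- Every inversion of `w` lies in exactly one occurrence of the decreasing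
pattern `w_0^{(k)}`: for every `i < j` with `w i > w j` there is exactly one
`k`-element set of positions containing `i` and `j` on which `w` is decreasing. -/
def EveryInvOnce (n k : ℕ) (w : Equiv.Perm (Fin n)) : Prop :=
  ∀ i j : Fin n, i < j → w j < w i →
    ∃! T : Finset (Fin n), T.card = k ∧ DecrOn n w T ∧ i ∈ T ∧ j ∈ T

/-- Equality of two patterns of (possibly a priori different) sizes. -/
def EqPat {k m : ℕ} (p : Equiv.Perm (Fin k)) (q : Equiv.Perm (Fin m)) : Prop :=
  ∃ h : k = m, ∀ i : Fin k, ((p i : ℕ) = (q (Fin.cast h i) : ℕ))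

/-- `L(n,k)`: the number of boolean permutations in `S_n` of length `k`. -/
noncomputable def LA (n k : ℕ) : ℕ :=
  Nat.card {w : Equiv.Perm (Fin n) // BooleanA n w ∧ lenA n w = k}

/-- `L` extended to integer arguments, with the convention that it vanishes
when `m < 1` or `j < 0`. -/
noncomputable def Lz (m j : ℤ) : ℤ :=
  if 1 ≤ m ∧ 0 ≤ j then (LA m.toNat j.toNat : ℤ) else 0

/-- `L^D(n,k)`: the number of boolean elements of `S_n^D` of length `k`. -/
noncomputable def LD (n k : ℕ) : ℕ :=
  Nat.card {w : Equiv.Perm ℤ // IsTypeD n w ∧ BooleanD n w ∧ lenD n w = k}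


/-- Rank function of a permutation. -/
def rk {n : ℕ} (w : Equiv.Perm (Fin n)) (i j : ℕ) : ℕ :=
  (Finset.univ.filter (fun k : Fin n => k.1 < i ∧ (w k).1 < j)).card

/-- Number of inversions. -/
def invN {n : ℕ} (w : Equiv.Perm (Fin n)) : ℕ :=
  (Finset.univ.filter (fun p : Fin n × Fin n => p.1 < p.2 ∧ w p.2 < w p.1)).card

/-- The rank (tableau) order. -/
def rle {n : ℕ} (v w : Equiv.Perm (Fin n)) : Prop := ∀ i j, rk w i j ≤ rk v i j

theorem sA_val {n i : ℕ} (h1 : 1 ≤ i) (h2 : i < n) (k : Fin n) :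
    ((sA n i) k).1 = if k.1 = i - 1 then i else if k.1 = i then i - 1 else k.1 := by
  simp only [sA, h1, h2, and_self, dite_true, Equiv.swap_apply_def, Fin.ext_iff]
  split_ifs <;> simp_all

theorem sA_sq (n i : ℕ) : sA n i * sA n i = 1 := by
  unfold sA
  split_ifs <;> simp

theorem sA_sA (n i : ℕ) (k : Fin n) : sA n i (sA n i k) = k := by
  rw [← Equiv.Perm.mul_apply, sA_sq]; rfl

theorem mul_sA_sA {n : ℕ} (i : ℕ) (w : Equiv.Perm (Fin n)) : w * sA n i * sA n i = w := by
  rw [mul_assoc, sA_sq, mul_one]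

theorem rk_succ {n : ℕ} (w : Equiv.Perm (Fin n)) (i j : ℕ) (hi : i < n) :
    rk w (i + 1) j = rk w i j + if (w ⟨i, hi⟩).1 < j then 1 else 0 := by
  unfold rk
  split_ifs with h
  · have : (Finset.univ.filter (fun k : Fin n => k.1 < i + 1 ∧ (w k).1 < j))
        = insert ⟨i, hi⟩ (Finset.univ.filter (fun k : Fin n => k.1 < i ∧ (w k).1 < j)) := by
      ext k
      simp only [Finset.mem_filter, Finset.mem_univ, true_and, Finset.mem_insert]
      constructor
      · rintro ⟨h1, h2⟩
        by_cases hk : k.1 = i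
        · left; exact Fin.ext hk
        · right; exact ⟨by omega, h2⟩
      · rintro (rfl | ⟨h1, h2⟩)
        · exact ⟨by simp, h⟩
        · exact ⟨by omega, h2⟩
    rw [this, Finset.card_insert_of_notMem (by simp)]
  · rw [add_zero]
    congr 1
    ext k
    simp only [Finset.mem_filter, Finset.mem_univ, true_and]
    constructor
    · rintro ⟨h1, h2⟩
      by_cases hk : k.1 = i
      · have : k = ⟨i, hi⟩ := Fin.ext hk
        subst this
        exact absurd h2 h
      · exact ⟨by omega, h2⟩
    · rintro ⟨h1, h2⟩
      exact ⟨by omega, h2⟩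

theorem rk_mul {n i : ℕ} (h1 : 1 ≤ i) (h2 : i < n) (w : Equiv.Perm (Fin n)) (i' j : ℕ)
    (hne : i' ≠ i) : rk (w * sA n i) i' j = rk w i' j := by
  unfold rk
  apply Finset.card_bij (fun k _ => sA n i k)
  · intro k hk
    rw [Finset.mem_filter] at hk ⊢
    refine ⟨Finset.mem_univ _, ?_⟩
    replace hk := hk.2
    refine ⟨?_, hk.2⟩
    rw [sA_val h1 h2]
    split_ifs <;> omega
  · intro a _ b _ h
    exact (sA n i).injective h
  · intro k hk
    simp only [Finset.mem_filter, Finset.mem_univ, true_and] at hk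
    refine ⟨sA n i k, ?_, sA_sA n i k⟩
    rw [Finset.mem_filter, Equiv.Perm.mul_apply, sA_sA]
    refine ⟨Finset.mem_univ _, ?_⟩
    refine ⟨?_, hk.2⟩
    rw [sA_val h1 h2]
    split_ifs <;> omega

/-- `w` has an ascent at position `i`. -/
def Asc {n : ℕ} (w : Equiv.Perm (Fin n)) (i : ℕ) : Prop :=
  ∃ (_ : 1 ≤ i) (h2 : i < n), w ⟨i - 1, by omega⟩ < w ⟨i, h2⟩

theorem asc_mul {n i : ℕ} (h1 : 1 ≤ i) (h2 : i < n) (w : Equiv.Perm (Fin n)) :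
    Asc (w * sA n i) i ↔ ¬ Asc w i := by
  have e1 : sA n i ⟨i - 1, by omega⟩ = ⟨i, h2⟩ := by
    apply Fin.ext; rw [sA_val h1 h2]; simp
  have e2 : sA n i ⟨i, h2⟩ = ⟨i - 1, by omega⟩ := by
    apply Fin.ext; rw [sA_val h1 h2]; simp
  have hne : w ⟨i - 1, by omega⟩ ≠ w ⟨i, h2⟩ := by
    intro h
    have := congrArg Fin.val (w.injective h)
    simp at this
    omega
  simp only [Asc, h1, h2, exists_true_left, Equiv.Perm.mul_apply, e1, e2, not_lt]
  exact ⟨le_of_lt, fun h => lt_of_le_of_ne h hne.symm⟩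

theorem rk_asc {n i : ℕ} (h1 : 1 ≤ i) (h2 : i < n) (w : Equiv.Perm (Fin n)) (j : ℕ) :
    rk w (i - 1) j ≤ rk w i j ∧ rk w i j ≤ rk w (i - 1) j + 1 ∧
    rk w i j ≤ rk w (i + 1) j ∧ rk w (i + 1) j ≤ rk w i j + 1 ∧
    (Asc w i → rk w i j = min (rk w (i + 1) j) (rk w (i - 1) j + 1)) ∧
    (¬ Asc w i → rk w i j = max (rk w (i - 1) j) (rk w (i + 1) j - 1)) := by
  have a := rk_succ w i j h2
  have b := rk_succ w (i - 1) j (by omega)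
  rw [Nat.sub_add_cancel h1] at b
  have hA : Asc w i ↔ (w ⟨i - 1, by omega⟩).1 < (w ⟨i, h2⟩).1 := by
    simp only [Asc, h1, h2, exists_true_left, Fin.lt_def]
  rw [hA]
  split_ifs at a b <;> omega

/-- Two permutations with an ascent at `i`. -/
theorem rle_asc {n i : ℕ} (h1 : 1 ≤ i) (h2 : i < n) {x y : Equiv.Perm (Fin n)}
    (hx : Asc x i) (h : ∀ i' j, i' ≠ i → rk y i' j ≤ rk x i' j) : rle x y := by
  intro i' j
  by_cases hi : i' = i
  · subst hi
    have a := rk_asc h1 h2 x j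
    have b := rk_asc h1 h2 y j
    have c := a.2.2.2.2.1 hx
    have d1 := h (i' - 1) j (by omega)
    have d2 := h (i' + 1) j (by omega)
    omega
  · exact h i' j hi

theorem rle_desc {n i : ℕ} (h1 : 1 ≤ i) (h2 : i < n) {x y : Equiv.Perm (Fin n)}
    (hy : ¬ Asc y i) (h : ∀ i' j, i' ≠ i → rk y i' j ≤ rk x i' j) : rle x y := by
  intro i' j
  by_cases hi : i' = i
  · subst hi
    have a := rk_asc h1 h2 x j
    have b := rk_asc h1 h2 y j
    have c := b.2.2.2.2.2 hy
    have d1 := h (i' - 1) j (by omega)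
    have d2 := h (i' + 1) j (by omega)
    omega
  · exact h i' j hi

theorem rle_one {n : ℕ} {v : Equiv.Perm (Fin n)} (h : rle v 1) : v = 1 := by
  have key : ∀ k : Fin n, (v k).1 ≤ k.1 := by
    intro k
    have hk := h (k.1 + 1) (k.1 + 1)
    unfold rk at hk
    have hsub : (Finset.univ.filter (fun a : Fin n => a.1 < k.1 + 1 ∧ (v a).1 < k.1 + 1)) ⊆
        (Finset.univ.filter (fun a : Fin n => a.1 < k.1 + 1 ∧
          ((1 : Equiv.Perm (Fin n)) a).1 < k.1 + 1)) := by
      intro a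
      simp +contextual
    have heq := Finset.eq_of_subset_of_card_le hsub hk
    have hm : k ∈ (Finset.univ.filter (fun a : Fin n => a.1 < k.1 + 1 ∧
          ((1 : Equiv.Perm (Fin n)) a).1 < k.1 + 1)) := by simp
    rw [← heq] at hm
    simp only [Finset.mem_filter] at hm
    omega
  have hs : ∑ k : Fin n, (v k).1 = ∑ k : Fin n, k.1 := Equiv.sum_comp v (fun k => k.1)
  have := (Finset.sum_eq_sum_iff_of_le (fun k _ => key k)).1 hs
  ext k
  simpa using this k (Finset.mem_univ k)

theorem inv_asc {n i : ℕ} (w : Equiv.Perm (Fin n)) (h : Asc w i) :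
    invN (w * sA n i) = invN w + 1 := by
  obtain ⟨h1, h2, hlt⟩ := h
  have e1 : sA n i ⟨i - 1, by omega⟩ = ⟨i, h2⟩ := by
    apply Fin.ext; rw [sA_val h1 h2]; simp
  have e2 : sA n i ⟨i, h2⟩ = ⟨i - 1, by omega⟩ := by
    apply Fin.ext; rw [sA_val h1 h2]; simp
  unfold invN
  have hc : (Finset.univ.filter (fun p : Fin n × Fin n =>
        p.1 < p.2 ∧ (w * sA n i) p.2 < (w * sA n i) p.1)).card =
      (Finset.univ.filter (fun p : Fin n × Fin n =>
        sA n i p.1 < sA n i p.2 ∧ w p.2 < w p.1)).card := by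
    apply Finset.card_bij (fun p _ => (sA n i p.1, sA n i p.2))
    · intro p hp
      rw [Finset.mem_filter] at hp ⊢
      simpa [sA_sA] using hp
    · intro a _ b _ hab
      simp only [Prod.mk.injEq, EmbeddingLike.apply_eq_iff_eq] at hab
      exact Prod.ext hab.1 hab.2
    · intro p hp
      refine ⟨(sA n i p.1, sA n i p.2), ?_, ?_⟩
      · rw [Finset.mem_filter] at hp ⊢
        simpa [sA_sA] using hp
      · simp [sA_sA]
  rw [hc]
  have : (Finset.univ.filter (fun p : Fin n × Fin n =>
        sA n i p.1 < sA n i p.2 ∧ w p.2 < w p.1)) =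
      insert (⟨i, h2⟩, ⟨i - 1, by omega⟩)
        (Finset.univ.filter (fun p : Fin n × Fin n => p.1 < p.2 ∧ w p.2 < w p.1)) := by
    ext ⟨a, b⟩
    simp only [Finset.mem_filter, Finset.mem_univ, true_and, Finset.mem_insert, Prod.mk.injEq]
    by_cases hab : a = ⟨i, h2⟩ ∧ b = ⟨i - 1, by omega⟩
    · obtain ⟨rfl, rfl⟩ := hab
      simp only [e1, e2, hlt, Fin.lt_def]
      simp
      omega
    · by_cases hba : a = ⟨i - 1, by omega⟩ ∧ b = ⟨i, h2⟩
      · obtain ⟨rfl, rfl⟩ := hba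
        simp only [e1, e2, not_lt_of_gt hlt, Fin.ext_iff]
        simp
        omega
      · simp only [hab, false_or]
        apply and_congr_left
        intro _
        simp only [Fin.ext_iff] at hab hba
        simp only [Fin.lt_def, sA_val h1 h2]
        split_ifs <;> omega
  rw [this, Finset.card_insert_of_notMem]
  simp only [Finset.mem_filter, Fin.lt_def]
  simp

theorem inv_desc {n i : ℕ} (h1 : 1 ≤ i) (h2 : i < n) (w : Equiv.Perm (Fin n))
    (h : ¬ Asc w i) : invN w = invN (w * sA n i) + 1 := by
  have := inv_asc _ ((asc_mul h1 h2 w).2 h)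
  rwa [mul_sA_sA] at this

theorem prodA_concat (n : ℕ) (b : List ℕ) (i : ℕ) :
    prodA n (b ++ [i]) = prodA n b * sA n i := by
  simp [prodA]

theorem isWord_concat (n : ℕ) (b : List ℕ) (i : ℕ) :
    IsWordA n (b ++ [i]) ↔ IsWordA n b ∧ 1 ≤ i ∧ i < n := by
  simp only [IsWordA, List.mem_append, List.mem_singleton]
  constructor
  · intro h
    have := h i (Or.inr rfl)
    exact ⟨fun j hj => h j (Or.inl hj), by omega, by omega⟩
  · rintro ⟨h, h1, h2⟩ j (hj | rfl)
    · exact h j hj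
    · omega

theorem inv_one (n : ℕ) : invN (1 : Equiv.Perm (Fin n)) = 0 := by
  unfold invN
  rw [Finset.card_eq_zero, Finset.filter_eq_empty_iff]
  rintro p _ ⟨h1, h2⟩
  exact absurd h1 (not_lt_of_gt h2)

theorem inv_le {n : ℕ} (b : List ℕ) (hb : IsWordA n b) : invN (prodA n b) ≤ b.length := by
  induction b using List.reverseRecOn with
  | nil => simp [prodA, inv_one]
  | append_singleton b i ih =>
    rw [isWord_concat] at hb
    rw [prodA_concat, List.length_append, List.length_singleton]
    have := ih hb.1
    by_cases h : Asc (prodA n b) i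
    · rw [inv_asc _ h]; omega
    · have := inv_desc hb.2.1 hb.2.2 _ h
      omega

theorem all_asc {n : ℕ} (w : Equiv.Perm (Fin n)) (h : ∀ i, 1 ≤ i → i < n → Asc w i) :
    w = 1 := by
  have hm : StrictMono w := by
    cases n with
    | zero => intro a; exact a.elim0
    | succ n =>
      rw [Fin.strictMono_iff_lt_succ]
      intro i
      obtain ⟨_, _, h3⟩ := h (i.1 + 1) (by omega) (by omega)
      exact h3
  have key : ∀ k : Fin n, k ≤ w k := fun k => hm.le_apply
  have hs : ∑ k : Fin n, (w k).1 = ∑ k : Fin n, k.1 := Equiv.sum_comp w (fun k => k.1)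
  have := (Finset.sum_eq_sum_iff_of_le (fun k _ => Fin.le_def.1 (key k))).1 hs.symm
  ext k
  simpa using (this k (Finset.mem_univ k)).symm

theorem exists_word {n : ℕ} (N : ℕ) : ∀ w : Equiv.Perm (Fin n), invN w = N →
    ∃ b, IsWordA n b ∧ prodA n b = w ∧ b.length = N := by
  induction N with
  | zero =>
    intro w hw
    refine ⟨[], by simp [IsWordA], ?_, rfl⟩
    rw [all_asc w]
    · simp [prodA]
    · intro i h1 h2
      by_contra h
      have := inv_desc h1 h2 w h
      omega
  | succ N ih =>
    intro w hw
    by_cases hall : ∀ i, 1 ≤ i → i < n → Asc w i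
    · rw [all_asc w hall, inv_one] at hw
      omega
    · push Not at hall
      obtain ⟨i, h1, h2, h⟩ := hall
      have := inv_desc h1 h2 w h
      obtain ⟨b, hb, hp, hl⟩ := ih (w * sA n i) (by omega)
      refine ⟨b ++ [i], (isWord_concat _ _ _).2 ⟨hb, h1, h2⟩, ?_, by simp [hl]⟩
      rw [prodA_concat, hp, mul_sA_sA]

theorem reduced_iff {n : ℕ} (b : List ℕ) (w : Equiv.Perm (Fin n)) :
    ReducedA n b w ↔ IsWordA n b ∧ prodA n b = w ∧ b.length = invN w := by
  constructor
  · rintro ⟨h1, h2, h3⟩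
    refine ⟨h1, h2, ?_⟩
    obtain ⟨c, hc, hp, hl⟩ := exists_word (invN w) w rfl
    have a1 := h3 c hc hp
    have a2 := inv_le b h1
    rw [h2] at a2
    omega
  · rintro ⟨h1, h2, h3⟩
    refine ⟨h1, h2, fun c hc hp => ?_⟩
    rw [h3, ← hp]
    exact inv_le c hc

theorem reduced_concat {n : ℕ} (b : List ℕ) (i : ℕ) (w : Equiv.Perm (Fin n)) :
    ReducedA n (b ++ [i]) w ↔
      1 ≤ i ∧ i < n ∧ ¬ Asc w i ∧ ReducedA n b (w * sA n i) := by
  rw [reduced_iff, reduced_iff, isWord_concat, prodA_concat, List.length_append,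
    List.length_singleton]
  constructor
  · rintro ⟨⟨hb, h1, h2⟩, hp, hl⟩
    have hp' : prodA n b = w * sA n i := by rw [← hp, mul_sA_sA]
    have hle := inv_le b hb
    rw [hp'] at hle
    have hd : ¬ Asc w i := by
      intro ha
      have := inv_asc w ha
      omega
    have := inv_desc h1 h2 w hd
    exact ⟨h1, h2, hd, hb, hp', by omega⟩
  · rintro ⟨h1, h2, hd, hb, hp, hl⟩
    have := inv_desc h1 h2 w hd
    exact ⟨⟨hb, h1, h2⟩, by rw [hp, mul_sA_sA], by omega⟩

theorem sub_rle {n : ℕ} (b : List ℕ) : ∀ (a : List ℕ) (v w : Equiv.Perm (Fin n)),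
    ReducedA n a v → ReducedA n b w → a.Sublist b → rle v w := by
  induction b using List.reverseRecOn with
  | nil =>
    intro a v w ha hb hs
    rw [List.sublist_nil] at hs
    subst hs
    rw [← ha.2.1, ← hb.2.1]
    exact fun _ _ => le_rfl
  | append_singleton b i ih =>
    intro a v w ha hb hs
    obtain ⟨h1, h2, hd, hb'⟩ := (reduced_concat _ _ _).1 hb
    rw [List.sublist_append_iff] at hs
    obtain ⟨l1, l2, rfl, hs1, hs2⟩ := hs
    apply rle_desc h1 h2 hd
    intro i' j hne
    rw [← rk_mul h1 h2 w i' j hne]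
    rcases List.sublist_singleton.1 hs2 with rfl | rfl
    · rw [List.append_nil] at ha
      exact ih _ _ _ ha hb' hs1 i' j
    · obtain ⟨_, _, _, ha'⟩ := (reduced_concat _ _ _).1 ha
      rw [← rk_mul h1 h2 v i' j hne]
      exact ih _ _ _ ha' hb' hs1 i' j

theorem rle_sub {n : ℕ} (b : List ℕ) : ∀ (v w : Equiv.Perm (Fin n)),
    ReducedA n b w → rle v w → ∃ a, ReducedA n a v ∧ a.Sublist b := by
  induction b using List.reverseRecOn with
  | nil =>
    intro v w hb h
    have hw : w = 1 := by rw [← hb.2.1]; simp [prodA]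
    subst hw
    rw [rle_one h]
    exact ⟨[], hb, List.Sublist.refl _⟩
  | append_singleton b i ih =>
    intro v w hb h
    obtain ⟨h1, h2, hd, hb'⟩ := (reduced_concat _ _ _).1 hb
    by_cases hv : Asc v i
    · obtain ⟨a, ha, hs⟩ := ih v _ hb' (rle_asc h1 h2 hv (by
        intro i' j hne
        rw [rk_mul h1 h2 w i' j hne]
        exact h i' j))
      exact ⟨a, ha, hs.trans (List.sublist_append_left _ _)⟩
    · obtain ⟨a, ha, hs⟩ := ih (v * sA n i) _ hb'
        (rle_asc h1 h2 ((asc_mul h1 h2 v).2 hv) (by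
          intro i' j hne
          rw [rk_mul h1 h2 w i' j hne, rk_mul h1 h2 v i' j hne]
          exact h i' j))
      exact ⟨a ++ [i], (reduced_concat _ _ _).2 ⟨h1, h2, hv, ha⟩, hs.append (List.Sublist.refl _)⟩

theorem bruhat_trans {n : ℕ} {u v w : Equiv.Perm (Fin n)} (h1 : bruhatA n u v)
    (h2 : bruhatA n v w) : bruhatA n u w := by
  obtain ⟨a, b, ha, hb, hs⟩ := h1
  obtain ⟨c, d, hc, hd, hs'⟩ := h2
  obtain ⟨e, he, hes⟩ := rle_sub c u v hc (sub_rle b a u v ha hb hs)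
  exact ⟨e, d, he, hd, hes.trans hs'⟩

theorem stmt7 (n : ℕ) (w v : Equiv.Perm (Fin n))
    (hw : Decomposable n w) (hvw : bruhatA n v w) : Decomposable n v := by
  obtain ⟨m, m', hm, hm', p, q, e, he⟩ := hw
  refine ⟨m, m', hm, hm', (e ⟨v, hvw⟩).1.1, (e ⟨v, hvw⟩).2.1,
    { toFun := fun x =>
        (⟨(e ⟨x.1, bruhat_trans x.2 hvw⟩).1.1, ((he ⟨x.1, bruhat_trans x.2 hvw⟩ ⟨v, hvw⟩).1 x.2).1⟩,
         ⟨(e ⟨x.1, bruhat_trans x.2 hvw⟩).2.1, ((he ⟨x.1, bruhat_trans x.2 hvw⟩ ⟨v, hvw⟩).1 x.2).2⟩)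
      invFun := fun y =>
        ⟨(e.symm (⟨y.1.1, bruhat_trans y.1.2 (e ⟨v, hvw⟩).1.2⟩,
            ⟨y.2.1, bruhat_trans y.2.2 (e ⟨v, hvw⟩).2.2⟩)).1, by
          refine (he _ ⟨v, hvw⟩).2 ?_
          rw [Equiv.apply_symm_apply]
          exact ⟨y.1.2, y.2.2⟩⟩
      left_inv := ?_
      right_inv := ?_ }, ?_⟩
  · intro x
    apply Subtype.ext
    simp
  · intro y
    simp
  · intro a b
    exact he ⟨a.1, _⟩ ⟨b.1, _⟩

end Paper
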